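/- Let R = ⊕_{n≥0} R_n be a commutative graded K-algebra over a field K, generated as a K-algebra by finitely many homogeneous elements, and suppose there is a constant C such that dim_K R_n ≤ C for all n ≥ 0. Then the Krull dimension of R is at most one. -/

import Mathlib

open scoped Cardinal

/-- The part of `R` of degree at most `m`. -/
def degLE {K R : Type*} [Field K] [CommRing R] [Algebra K R]
    (ℳ : ℕ → Submodule K R) (m : ℕ) : Submodule K R :=
  Submodule.span K {x | ∃ n ≤ m, x ∈ ℳ n}

section
variable {K R : Type*} [Field K] [CommRing R] [Algebra K R] (ℳ : ℕ → Submodule K R)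

lemma degLE_mono {a b : ℕ} (h : a ≤ b) : degLE ℳ a ≤ degLE ℳ b :=
  Submodule.span_mono fun _ ⟨n, hn, hx⟩ => ⟨n, hn.trans h, hx⟩

lemma degLE_mul [GradedAlgebra ℳ] {a b : ℕ} {x y : R} (hx : x ∈ degLE ℳ a)
    (hy : y ∈ degLE ℳ b) : x * y ∈ degLE ℳ (a + b) := by
  have h : degLE ℳ a * degLE ℳ b ≤ degLE ℳ (a + b) := by
    unfold degLE
    rw [Submodule.span_mul_span]
    apply Submodule.span_mono
    rintro _ ⟨u, ⟨n, hn, hu⟩, v, ⟨k, hk, hv⟩, rfl⟩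
    exact ⟨n + k, by omega, SetLike.mul_mem_graded hu hv⟩
  exact h (Submodule.mul_mem_mul hx hy)

lemma degLE_one [GradedAlgebra ℳ] : (1 : R) ∈ degLE ℳ 0 :=
  Submodule.subset_span ⟨0, le_rfl, SetLike.one_mem_graded ℳ⟩

lemma degLE_pow [GradedAlgebra ℳ] {a : ℕ} {x : R} (hx : x ∈ degLE ℳ a) (i : ℕ) :
    x ^ i ∈ degLE ℳ (a * i) := by
  induction i with
  | zero => simpa using degLE_one ℳ
  | succ i ih => rw [pow_succ, Nat.mul_succ]; exact degLE_mul ℳ ih hx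

lemma exists_mem_degLE [GradedAlgebra ℳ] (x : R) : ∃ m, x ∈ degLE ℳ m := by
  classical
  refine ⟨(DirectSum.decompose ℳ x).support.sup id, ?_⟩
  rw [← DirectSum.sum_support_decompose ℳ x]
  refine Submodule.sum_mem _ fun i hi => Submodule.subset_span ⟨i, ?_, SetLike.coe_mem _⟩
  rw [DirectSum.sum_support_decompose ℳ x]
  exact Finset.le_sup (f := id) hi

lemma rank_degLE (C : ℕ) (hdim : ∀ n, Module.rank K (ℳ n) ≤ C) (m : ℕ) :
    Module.rank K (degLE ℳ m) ≤ (((m + 1) * C : ℕ) : Cardinal) := by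
  induction m with
  | zero =>
    have : degLE ℳ 0 ≤ ℳ 0 := by
      refine Submodule.span_le.2 ?_
      rintro x ⟨n, hn, hx⟩
      obtain rfl : n = 0 := by omega
      exact hx
    simpa using (Submodule.rank_mono this).trans (hdim 0)
  | succ m ih =>
    have : degLE ℳ (m + 1) ≤ degLE ℳ m ⊔ ℳ (m + 1) := by
      refine Submodule.span_le.2 ?_
      rintro x ⟨n, hn, hx⟩
      rcases Nat.lt_or_ge m n with h | h
      · obtain rfl : n = m + 1 := by omega
        exact Submodule.mem_sup_right hx
      · exact Submodule.mem_sup_left (Submodule.subset_span ⟨n, h, hx⟩)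
    refine (Submodule.rank_mono this).trans ((Submodule.rank_add_le_rank_add_rank _ _).trans ?_)
    refine (add_le_add ih (hdim (m + 1))).trans ?_
    rw [← Nat.cast_add]
    exact Nat.cast_le.2 (by ring_nf; exact le_rfl)

lemma ringKrullDim_le_of_integral_hom {A B : Type*} [CommRing A] [CommRing B] (g : A →+* B)
    (hg : g.IsIntegral) : ringKrullDim B ≤ ringKrullDim A := by
  algebraize [g]
  refine Order.krullDim_le_of_strictMono (PrimeSpectrum.comap g) fun I J h => ?_
  exact Ideal.IsIntegral.comap_lt_comap (R := A) (I := I.asIdeal) (J := J.asIdeal) h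

lemma no_two_indep [GradedAlgebra ℳ] (C : ℕ) (hdim : ∀ n, Module.rank K (ℳ n) ≤ C)
    {s : ℕ} (g : MvPolynomial (Fin s) K →ₐ[K] R) (hg : Function.Injective g)
    (a b : Fin s) (hab : a ≠ b) : False := by
  obtain ⟨p, hp⟩ := exists_mem_degLE ℳ (g (MvPolynomial.X a))
  obtain ⟨q, hq⟩ := exists_mem_degLE ℳ (g (MvPolynomial.X b))
  set N := C * (p + q + 1) with hN
  set M := p * N + q * N with hM
  let e : Fin (N + 1) × Fin (N + 1) → (Fin s →₀ ℕ) :=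
    fun ij => Finsupp.single a (ij.1 : ℕ) + Finsupp.single b (ij.2 : ℕ)
  have he : Function.Injective e := by
    rintro ⟨i, j⟩ ⟨i', j'⟩ h
    have h1 := DFunLike.congr_fun h a
    have h2 := DFunLike.congr_fun h b
    simp only [e, Finsupp.add_apply, Finsupp.single_eq_same, Finsupp.single_eq_of_ne hab,
      Finsupp.single_eq_of_ne hab.symm, add_zero, zero_add] at h1 h2
    exact Prod.ext (Fin.ext h1) (Fin.ext h2)
  have hli := ((MvPolynomial.basisMonomials (Fin s) K).linearIndependent.comp e he).map'
    g.toLinearMap (LinearMap.ker_eq_bot.2 hg)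
  have hmem : ∀ ij, (g.toLinearMap ∘ (MvPolynomial.basisMonomials (Fin s) K) ∘ e) ij
      ∈ degLE ℳ M := by
    rintro ⟨i, j⟩
    have : (g.toLinearMap ∘ (MvPolynomial.basisMonomials (Fin s) K) ∘ e) (i, j)
        = g (MvPolynomial.X a) ^ (i : ℕ) * g (MvPolynomial.X b) ^ (j : ℕ) := by
      simp only [Function.comp_apply, MvPolynomial.coe_basisMonomials, AlgHom.toLinearMap_apply, e,
        ← map_pow, ← map_mul, MvPolynomial.X_pow_eq_monomial, MvPolynomial.monomial_mul, one_mul]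
    rw [this]
    refine degLE_mono ℳ ?_ (degLE_mul ℳ (degLE_pow ℳ hp i) (degLE_pow ℳ hq j))
    exact Nat.add_le_add (Nat.mul_le_mul_left _ (by omega)) (Nat.mul_le_mul_left _ (by omega))
  have hr := rank_degLE ℳ C hdim M
  have : FiniteDimensional K (degLE ℳ M) :=
    Module.rank_lt_aleph0_iff.1 (hr.trans_lt (Cardinal.natCast_lt_aleph0))
  have hli' : LinearIndependent K (fun ij => (⟨_, hmem ij⟩ : degLE ℳ M)) :=
    LinearIndependent.of_comp (degLE ℳ M).subtype hli
  have hc := hli'.fintype_card_le_finrank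
  have hf : Module.finrank K (degLE ℳ M) ≤ (M + 1) * C := by
    rw [← Module.finrank_eq_rank] at hr
    exact_mod_cast hr
  simp only [Fintype.card_prod, Fintype.card_fin] at hc
  have h3 : (M + 1) * C ≤ N * (N + 1) := by
    rw [hM]
    calc (p * N + q * N + 1) * C ≤ ((p + q + 1) * (N + 1)) * C :=
          Nat.mul_le_mul_right _ (by nlinarith [Nat.zero_le p, Nat.zero_le q])
      _ = N * (N + 1) := by rw [hN]; ring
  nlinarith

end


/-- A commutative graded `K`-algebra `R = ⊕ₙ Rₙ`, generated as a `K`-algebra by finitely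
many homogeneous elements, whose homogeneous components have uniformly bounded
`K`-dimension, has Krull dimension at most one. -/
theorem stmt5 {K R : Type*} [Field K] [CommRing R] [Algebra K R]
    (ℳ : ℕ → Submodule K R) [GradedAlgebra ℳ]
    (hfg : ∃ s : Finset R, (∀ x ∈ s, ∃ n, x ∈ ℳ n) ∧
      Algebra.adjoin K (s : Set R) = ⊤)
    (C : ℕ) (hdim : ∀ n, Module.rank K (ℳ n) ≤ C) :
    ringKrullDim R ≤ 1 := by
  rcases subsingleton_or_nontrivial R with h | h
  · rw [ringKrullDim_eq_bot_of_subsingleton]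
    exact bot_le
  obtain ⟨s, -, hs⟩ := hfg
  have : Algebra.FiniteType K R := ⟨⟨s, hs⟩⟩
  obtain ⟨d, g, hg, hint⟩ := exists_integral_inj_algHom_of_fg K R
  have hd : d ≤ 1 := by
    by_contra! hd
    exact no_two_indep ℳ C hdim g hg ⟨0, by omega⟩ ⟨1, by omega⟩ (by simp)
  refine (ringKrullDim_le_of_integral_hom _ hint).trans ?_
  rw [MvPolynomial.ringKrullDim_of_isNoetherianRing, ringKrullDim_eq_zero_of_field]
  simpa using hd
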